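/- Let (R, m) be an F-finite regular local ring of characteristic p > 0, q = p^e, and f ∈ R. Define ν^{(q)}(f) = sup{n : f ∈ R^q + m^n} and η(f) = min_{1 ≤ i ≤ q−1} ( ν(Diff_{R,+}^i(f)) + i ), where ν denotes the m-adic order of an ideal. Then ν^{(q)}(f) ≤ η(f), and if ν^{(q)}(f) is finite and not divisible by q, then ν^{(q)}(f) = η(f). -/

import Mathlib

/-- `IsDiffOp R n D` : `D` is an (absolute) differential operator of `R` of order at most `n`,
defined inductively: order `≤ 0` means `R`-linear, and `D` has order `≤ n+1` if all the
commutators `[D, mulLeft r]` have order `≤ n`.  (For commutative rings this agrees with the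
definition via the left `R`-linear extension of `D` to `R ⊗ R` annihilating `T_R^{n+1}`.) -/
def IsDiffOp (R : Type*) [CommRing R] : ℕ → (R →+ R) → Prop
  | 0, D => ∀ r s : R, D (r * s) = r * D s
  | n + 1, D => ∀ r : R,
      IsDiffOp R n ((D.comp (AddMonoidHom.mulLeft r)) - ((AddMonoidHom.mulLeft r).comp D))


/-- A Noetherian local ring is regular when its maximal ideal is generated by a regular
sequence. -/
def IsRegularLocal (R : Type*) [CommRing R] [IsLocalRing R] : Prop :=
  IsNoetherianRing R ∧ ∃ rs : List R,
    RingTheory.Sequence.IsRegular R rs ∧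
    Ideal.span {x | x ∈ rs} = IsLocalRing.maximalIdeal R

/-- The `q`-order `ν^{(q)}(f) = sup {n : f ∈ R^q + m^n}` (as an extended natural). -/
noncomputable def nuQ (R : Type*) [CommRing R] [IsLocalRing R] (q : ℕ) (f : R) : ℕ∞ :=
  sSup {n : ℕ∞ | ∃ m : ℕ, n = (m : ℕ∞) ∧
    ∃ lam : R, f - lam ^ q ∈ IsLocalRing.maximalIdeal R ^ m}

/-- The order `ν(I) = sup {n : I ⊆ m^n}` of an ideal at the local ring. -/
noncomputable def ordIdeal (R : Type*) [CommRing R] [IsLocalRing R] (I : Ideal R) : ℕ∞ :=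
  sSup {n : ℕ∞ | ∃ m : ℕ, n = (m : ℕ∞) ∧ I ≤ IsLocalRing.maximalIdeal R ^ m}

/-- The ideal `Diff_{R,+}^i(f)` generated by evaluations on `f` of differential operators
of order at most `i` annihilating `1`. -/
def diffIdealPlus (R : Type*) [CommRing R] (i : ℕ) (f : R) : Ideal R :=
  Ideal.span {y : R | ∃ D : R →+ R, IsDiffOp R i D ∧ D 1 = 0 ∧ D f = y}

/-- `η(f) = min_{1 ≤ i ≤ q-1} ( ν(Diff_{R,+}^i(f)) + i )`. -/
noncomputable def etaF (R : Type*) [CommRing R] [IsLocalRing R] (q : ℕ) (f : R) : ℕ∞ :=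
  ⨅ i ∈ Finset.Icc 1 (q - 1), (ordIdeal R (diffIdealPlus R i f) + (i : ℕ∞))


open IsLocalRing in
theorem IsDiffOp.mem_pow {R : Type*} [CommRing R] (I : Ideal R) :
    ∀ (n : ℕ) (D : R →+ R), IsDiffOp R n D → ∀ (k : ℕ) (g : R), g ∈ I ^ k → D g ∈ I ^ (k - n) := by
  intro n
  induction n with
  | zero =>
    intro D hD k g hg
    have := hD g 1
    rw [mul_one] at this
    rw [this]
    exact Ideal.mul_mem_right _ _ hg
  | succ n ih =>
    intro D hD k
    induction k with
    | zero => intro g _; simp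
    | succ k ihk =>
      intro g hg
      rw [pow_succ'] at hg
      refine Submodule.mul_induction_on hg ?_ ?_
      · intro y hy h hh
        have h1 := ih _ (hD y) k h hh
        simp only [AddMonoidHom.sub_apply, AddMonoidHom.comp_apply, AddMonoidHom.coe_mulLeft] at h1
        have h2 : y * D h ∈ I ^ (k - (n + 1) + 1) := by
          rw [pow_succ']
          exact Ideal.mul_mem_mul hy (ihk h hh)
        have h3 : y * D h ∈ I ^ (k - n) := Ideal.pow_le_pow_right (by omega) h2
        have h4 : k + 1 - (n + 1) = k - n := by omega
        rw [h4]
        have := add_mem h1 h3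
        simpa using this
      · intro a b ha hb
        rw [map_add]; exact add_mem ha hb

theorem IsDiffOp.mul_left {R : Type*} [CommRing R] :
    ∀ (n : ℕ) (D : R →+ R), IsDiffOp R n D → ∀ a : R,
      IsDiffOp R n ((AddMonoidHom.mulLeft a).comp D) := by
  intro n
  induction n with
  | zero => intro D hD a r s; simp [hD r s]; ring
  | succ n ih =>
    intro D hD a r
    have := ih _ (hD r) a
    convert this using 1
    ext s
    simp
    ring

theorem IsDiffOp.add {R : Type*} [CommRing R] :
    ∀ (n : ℕ) (D D' : R →+ R), IsDiffOp R n D → IsDiffOp R n D' → IsDiffOp R n (D + D') := by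
  intro n
  induction n with
  | zero => intro D D' hD hD' r s; simp [hD r s, hD' r s]; ring
  | succ n ih =>
    intro D D' hD hD' r
    have := ih _ _ (hD r) (hD' r)
    convert this using 1
    ext s
    simp
    ring

theorem IsDiffOp.zero {R : Type*} [CommRing R] :
    ∀ (n : ℕ), IsDiffOp R n (0 : R →+ R) := by
  intro n
  induction n with
  | zero => intro r s; simp
  | succ n ih =>
    intro r
    convert ih using 1
    ext s
    simp

theorem IsDiffOp.succ {R : Type*} [CommRing R] :
    ∀ (n : ℕ) (D : R →+ R), IsDiffOp R n D → IsDiffOp R (n + 1) D := by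
  intro n
  induction n with
  | zero =>
    intro D hD r
    convert IsDiffOp.zero 0 using 1
    ext s
    simp [hD r s]
  | succ n ih =>
    intro D hD r
    exact ih _ (hD r)

theorem IsDiffOp.mono {R : Type*} [CommRing R] {n k : ℕ} (h : n ≤ k) {D : R →+ R}
    (hD : IsDiffOp R n D) : IsDiffOp R k D := by
  induction h with
  | refl => exact hD
  | step _ ih => exact IsDiffOp.succ _ _ ih

theorem IsDiffOp.sum {R : Type*} [CommRing R] {n : ℕ} {κ : Type*} (s : Finset κ)
    (D : κ → R →+ R) (h : ∀ i ∈ s, IsDiffOp R n (D i)) : IsDiffOp R n (∑ i ∈ s, D i) := by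
  classical
  induction s using Finset.induction_on with
  | empty => simpa using IsDiffOp.zero n
  | insert a s ha ih =>
    rw [Finset.sum_insert ha]
    exact IsDiffOp.add _ _ _ (h _ (Finset.mem_insert_self _ _))
      (ih fun i hi => h i (Finset.mem_insert_of_mem hi))

theorem IsDiffOp.pow_comm {R : Type*} [CommRing R] (p : ℕ) [hp : Fact p.Prime] [CharP R p]
    (e n : ℕ) (hn : n < p ^ e) (D : R →+ R) (hD : IsDiffOp R n D) (r s : R) :
    D (r ^ (p ^ e) * s) = r ^ (p ^ e) * D s := by
  let L : Module.End ℤ R := LinearMap.mulLeft ℤ r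
  let X : Module.End ℤ (Module.End ℤ R) := LinearMap.mulRight ℤ L
  let Y : Module.End ℤ (Module.End ℤ R) := LinearMap.mulLeft ℤ L
  have hXk : ∀ (k : ℕ) (T : Module.End ℤ R), (X ^ k) T = T * L ^ k := by
    intro k T
    simp [X, LinearMap.pow_mulRight]
  have hYk : ∀ (k : ℕ) (T : Module.End ℤ R), (Y ^ k) T = L ^ k * T := by
    intro k T
    simp [Y, LinearMap.pow_mulLeft]
  have hLk : ∀ (k : ℕ) (x : R), (L ^ k) x = r ^ k * x := by
    intro k x
    simp [L, LinearMap.pow_mulLeft]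
  have hcomm : Commute (X - Y) Y :=
    (LinearMap.commute_mulLeft_right (R := ℤ) L L).symm.sub_left (Commute.refl _)
  have hnil : ∀ (n : ℕ) (T : R →+ R), IsDiffOp R n T →
      ((X - Y) ^ (n + 1)) T.toIntLinearMap = 0 := by
    intro n
    induction n with
    | zero =>
      intro T hT
      ext x
      simp only [zero_add, pow_one]
      change T (r * x) - r * T x = 0
      rw [hT r x, sub_self]
    | succ n ih =>
      intro T hT
      rw [pow_succ, Module.End.mul_apply]
      exact ih _ (hT r)
  have hq0 : ((X - Y) ^ (p ^ e)) D.toIntLinearMap = 0 := by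
    obtain ⟨k, hk⟩ := Nat.exists_eq_add_of_lt hn
    rw [hk, show n + k + 1 = k + (n + 1) by ring, pow_add, Module.End.mul_apply, hnil n D hD,
      map_zero]
  obtain ⟨T, hT⟩ := hcomm.exists_add_pow_prime_pow_eq hp.out e
  rw [sub_add_cancel] at hT
  have h1 := congrArg (fun Z : Module.End ℤ (Module.End ℤ R) => (Z D.toIntLinearMap) s) hT
  have h2 : ∀ (Z : Module.End ℤ (Module.End ℤ R)) (W : Module.End ℤ R),
      (((p : Module.End ℤ (Module.End ℤ R)) * Z) W) s = 0 := by
    intro Z W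
    rw [Module.End.mul_apply, Module.End.natCast_apply, LinearMap.smul_apply, nsmul_eq_mul,
      CharP.cast_eq_zero, zero_mul]
  simp only [LinearMap.add_apply, hq0, mul_assoc, h2] at h1
  simpa [hXk, hYk, hLk] using h1

/-- Monomials in `z` with exponents `< q` are independent over `R^q`. -/
def QInd {R : Type*} [CommRing R] (q : ℕ) {n : ℕ} (z : Fin n → R) : Prop :=
  ∀ c : (Fin n → Fin q) → R,
    ∑ γ, c γ ^ q * ∏ i, z i ^ (γ i : ℕ) = 0 → ∀ γ, c γ = 0

/-- `R` is generated as a ring by `R^q` and `z`. -/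
def QGen {R : Type*} [CommRing R] (q : ℕ) {n : ℕ} (z : Fin n → R) : Prop :=
  Subring.closure (Set.range (fun r : R => r ^ q) ∪ Set.range z) = ⊤

theorem sum_cons {R : Type*} [CommRing R] (q : ℕ) {n : ℕ} (y : R) (z : Fin n → R)
    (c : (Fin (n + 1) → Fin q) → R) :
    ∑ γ, c γ ^ q * ∏ i, (Fin.cons y z : Fin (n + 1) → R) i ^ (γ i : ℕ) =
      ∑ j : Fin q, (∑ γ : Fin n → Fin q,
        c (Fin.cons j γ) ^ q * ∏ i, z i ^ (γ i : ℕ)) * y ^ (j : ℕ) := by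
  rw [← (Fin.consEquiv (fun _ : Fin (n + 1) => Fin q)).sum_comp, Fintype.sum_prod_type]
  refine Finset.sum_congr rfl fun j _ => ?_
  rw [Finset.sum_mul]
  refine Finset.sum_congr rfl fun γ _ => ?_
  simp [Fin.consEquiv, Fin.prod_univ_succ]
  ring

theorem QInd.pow {R : Type*} [CommRing R] (p : ℕ) [hp : Fact p.Prime] [CharP R p] {n : ℕ}
    (z : Fin n → R) (h : QInd p z) : ∀ e : ℕ, QInd (p ^ e) z := by
  intro e
  induction e with
  | zero =>
    rw [pow_zero]
    intro c hc γ
    rw [Fintype.sum_eq_single γ (fun δ h => absurd (Subsingleton.elim _ _) h)] at hc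
    simpa using hc
  | succ e ih =>
    rw [pow_succ]
    intro c hc
    let E : (Fin n → Fin (p ^ e)) × (Fin n → Fin p) ≃ (Fin n → Fin (p ^ e * p)) :=
      (Equiv.arrowProdEquivProdArrow (Fin n) (fun _ => Fin (p ^ e)) (fun _ => Fin p)).symm.trans
        (Equiv.arrowCongr (Equiv.refl _) finProdFinEquiv)
    have hE : ∀ δ β i, ((E (δ, β) i : Fin (p ^ e * p)) : ℕ) = β i + p * δ i := by
      intro δ β i
      rfl
    rw [← E.sum_comp, Fintype.sum_prod_type_right] at hc
    have key := h (fun β => ∑ δ, c (E (δ, β)) ^ (p ^ e) * ∏ i, z i ^ (δ i : ℕ)) (by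
      rw [← hc]
      refine Finset.sum_congr rfl fun β _ => ?_
      rw [sum_pow_char, Finset.sum_mul]
      refine Finset.sum_congr rfl fun δ _ => ?_
      simp only [hE, pow_add, Finset.prod_mul_distrib, mul_pow, pow_mul', ← Finset.prod_pow]
      ring)
    intro γ
    obtain ⟨⟨δ, β⟩, rfl⟩ := E.surjective γ
    exact ih (fun δ => c (E (δ, β))) (key β) δ

theorem QGen.pow {R : Type*} [CommRing R] (p : ℕ) [hp : Fact p.Prime] [CharP R p] {n : ℕ}
    (z : Fin n → R) (h : QGen p z) : ∀ e : ℕ, QGen (p ^ e) z := by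
  intro e
  induction e with
  | zero =>
    rw [QGen, eq_top_iff]
    intro r _
    exact Subring.subset_closure (Or.inl ⟨r, by simp⟩)
  | succ e ih =>
    have h1 : ∀ r : R, r ^ p ∈
        Subring.closure (Set.range (fun r : R => r ^ (p ^ (e + 1))) ∪ Set.range z) := by
      intro r
      have hr : r ∈ Subring.closure (Set.range (fun r : R => r ^ (p ^ e)) ∪ Set.range z) := by
        rw [ih]; trivial
      induction hr using Subring.closure_induction with
      | mem x hx =>
        rcases hx with ⟨s, rfl⟩ | hx
        · refine Subring.subset_closure (Or.inl ⟨s, ?_⟩)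
          simp only [pow_succ, pow_mul]
        · have hx' : x ∈ Set.range (fun r : R => r ^ (p ^ (e + 1))) ∪ Set.range z := Or.inr hx
          exact pow_mem (Subring.subset_closure hx') _
      | zero => rw [zero_pow hp.out.ne_zero]; exact zero_mem _
      | one => rw [one_pow]; exact one_mem _
      | add x y _ _ hx hy => rw [add_pow_char]; exact add_mem hx hy
      | neg x _ hx =>
        have : (-x) ^ p = (-1 : R) ^ p * x ^ p := by rw [← mul_pow]; simp
        rw [this]
        exact mul_mem (pow_mem (neg_mem (one_mem _)) _) hx
      | mul x y _ _ hx hy => rw [mul_pow]; exact mul_mem hx hy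
    rw [QGen, eq_top_iff, ← h, Subring.closure_le]
    rintro x (⟨r, rfl⟩ | hx)
    · exact h1 r
    · exact Subring.subset_closure (Or.inr hx)

/-- cardinality bound for a finite ring map out of a field -/
theorem card_bound {A B : Type*} [Field A] [CommRing B] (f : A →+* B) (hf : f.Finite) :
    ∃ M : ℕ, ∀ (κ : Type) [Fintype κ] (v : κ → B),
      (∀ c : κ → A, ∑ i, f (c i) * v i = 0 → ∀ i, c i = 0) → Fintype.card κ ≤ M := by
  algebraize [f]
  refine ⟨Module.finrank A B, fun κ _ v hv => ?_⟩
  have : LinearIndependent A v := by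
    rw [Fintype.linearIndependent_iff]
    intro g hg i
    refine hv g ?_ i
    simp only [Algebra.smul_def] at hg
    exact hg
  exact this.fintype_card_le_finrank

theorem QInd.extend {k : Type*} [Field k] (p : ℕ) [hp : Fact p.Prime] [CharP k p] {n : ℕ}
    (z : Fin n → k) (h : QInd p z) (hg : ¬ QGen p z) :
    ∃ y : k, QInd p (Fin.cons y z : Fin (n + 1) → k) := by
  let S := Subring.closure (Set.range (fun r : k => r ^ p) ∪ Set.range z)
  have hpow : ∀ r : k, r ^ p ∈ S := fun r => Subring.subset_closure (Or.inl ⟨r, rfl⟩)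
  have hz : ∀ i, z i ∈ S := fun i => Subring.subset_closure (Or.inr ⟨i, rfl⟩)
  let L : Subfield k :=
    { S with
      inv_mem' := by
        intro x hx
        by_cases h0 : x = 0
        · subst h0; simp
        have : x⁻¹ = (x⁻¹) ^ p * x ^ (p - 1) := by
          obtain ⟨m, hm⟩ := Nat.exists_eq_succ_of_ne_zero hp.out.ne_zero
          rw [hm]
          simp only [Nat.succ_eq_add_one, Nat.add_sub_cancel, pow_succ]
          rw [mul_right_comm, ← mul_pow, inv_mul_cancel₀ h0, one_pow, one_mul]
        rw [this]
        exact mul_mem (hpow _) (pow_mem hx _) }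
  have hLS : ∀ x, x ∈ L ↔ x ∈ S := fun x => Iff.rfl
  obtain ⟨y, hy⟩ : ∃ y, y ∉ S := by
    by_contra hcon
    push Not at hcon
    exact hg (by rw [QGen, eq_top_iff]; intro x _; exact hcon x)
  refine ⟨y, ?_⟩
  intro c hc
  rw [sum_cons] at hc
  let A : Fin p → L := fun j => ⟨∑ γ : Fin n → Fin p,
        c (Fin.cons j γ) ^ p * ∏ i, z i ^ (γ i : ℕ),
        sum_mem fun γ _ => mul_mem (hpow _) (prod_mem fun i _ => pow_mem (hz i) _)⟩
  let a : L := ⟨y ^ p, hpow y⟩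
  have hirr : Irreducible (Polynomial.X ^ p - Polynomial.C a : Polynomial L) := by
    apply X_pow_sub_C_irreducible_of_prime hp.out
    intro b hb
    have : (b : k) ^ p = y ^ p := congrArg Subtype.val hb
    have : (b : k) = y := frobenius_inj k p this
    exact hy (this ▸ b.2)
  let P : Polynomial L := ∑ j : Fin p, Polynomial.C (A j) * Polynomial.X ^ (j : ℕ)
  have hPy : Polynomial.aeval y P = 0 := by
    simp only [P, map_sum, map_mul, Polynomial.aeval_C, map_pow, Polynomial.aeval_X]
    exact hc
  have hmin : (Polynomial.X ^ p - Polynomial.C a : Polynomial L) = minpoly L y := by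
    refine minpoly.eq_of_irreducible_of_monic hirr ?_ (Polynomial.monic_X_pow_sub_C _ hp.out.ne_zero)
    simp only [map_sub, map_pow, Polynomial.aeval_X, Polynomial.aeval_C]
    exact sub_self _
  have hdeg : P.degree < p := by
    refine lt_of_le_of_lt (Polynomial.degree_sum_le _ _) ?_
    rw [Finset.sup_lt_iff (by exact WithBot.bot_lt_coe _)]
    intro j _
    refine lt_of_le_of_lt (Polynomial.degree_C_mul_X_pow_le _ _) ?_
    exact_mod_cast j.isLt
  have hP0 : P = 0 := by
    by_contra hne
    have := Polynomial.degree_le_of_dvd (minpoly.dvd L y hPy) hne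
    rw [← hmin, Polynomial.degree_X_pow_sub_C hp.out.pos] at this
    exact absurd hdeg (not_lt.mpr this)
  have hA : ∀ j, A j = 0 := by
    intro j
    have := congrArg (fun Q => Polynomial.coeff Q (j : ℕ)) hP0
    simpa [P, Polynomial.finsetSum_coeff, Polynomial.coeff_X_pow, Fin.val_inj] using this
  intro γ
  have h1 := h (fun δ => c (Fin.cons (γ 0) δ)) (congrArg Subtype.val (hA (γ 0))) (Fin.tail γ)
  simpa using h1

theorem exists_pbasis_field {k : Type*} [Field k] (p : ℕ) [hp : Fact p.Prime] [CharP k p]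
    (hF : (frobenius k p).Finite) : ∃ (n : ℕ) (z : Fin n → k), QInd p z ∧ QGen p z := by
  by_contra hcon
  push Not at hcon
  have hall : ∀ n : ℕ, ∃ z : Fin n → k, QInd p z := by
    intro n
    induction n with
    | zero =>
      refine ⟨Fin.elim0, ?_⟩
      intro c hc γ
      rw [Fintype.sum_eq_single γ (fun δ h => absurd (Subsingleton.elim _ _) h)] at hc
      simpa [hp.out.ne_zero] using hc
    | succ n ih =>
      obtain ⟨z, hz⟩ := ih
      obtain ⟨y, hy⟩ := hz.extend p z (hcon n z hz)
      exact ⟨_, hy⟩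
  obtain ⟨M, hM⟩ := card_bound _ hF
  obtain ⟨z, hz⟩ := hall M
  have := hM (Fin M → Fin p) (fun γ => ∏ i, z i ^ (γ i : ℕ)) (by
    intro c hc
    exact hz c (by simpa [frobenius_def] using hc))
  simp at this
  exact absurd (Nat.lt_pow_self hp.out.one_lt) (not_lt.mpr this)

theorem nakayama_hom {A B : Type*} [CommRing A] [IsLocalRing A] [CommRing B] (f : A →+* B)
    (hf : f.Finite) (N : Subring B) (hN : ∀ a, f a ∈ N) (x : A)
    (hx : x ∈ IsLocalRing.maximalIdeal A)
    (h : ∀ b, ∃ s ∈ N, ∃ t, b = s + f x * t) : N = ⊤ := by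
  algebraize [f]
  let N' : Submodule A B :=
    { N with
      smul_mem' := by
        intro a b hb
        rw [Algebra.smul_def]
        exact N.mul_mem (hN a) hb }
  have key : (⊤ : Submodule A B) ≤ N' := by
    apply Submodule.le_of_le_smul_of_le_jacobson_bot (I := IsLocalRing.maximalIdeal A)
      Module.Finite.fg_top (IsLocalRing.maximalIdeal_le_jacobson _)
    intro b _
    obtain ⟨s, hs, t, rfl⟩ := h b
    refine Submodule.add_mem_sup hs ?_
    have : f x * t = x • t := by rw [Algebra.smul_def]; rfl
    rw [this]
    exact Submodule.smul_mem_smul hx trivial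
  rw [eq_top_iff]
  intro b _
  exact key (show b ∈ (⊤ : Submodule A B) from trivial)

theorem QGen.lift {R : Type*} [CommRing R] [IsLocalRing R] (p : ℕ) [hp : Fact p.Prime]
    [CharP R p] (hF : (frobenius R p).Finite) (x : R) (hx : x ∈ IsLocalRing.maximalIdeal R)
    {n : ℕ} (z : Fin n → R)
    (h : QGen p (fun i => Ideal.Quotient.mk (Ideal.span {x}) (z i))) :
    QGen p (Fin.cons x z : Fin (n + 1) → R) := by
  let N := Subring.closure (Set.range (fun r : R => r ^ p) ∪
    Set.range (Fin.cons x z : Fin (n + 1) → R))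
  have hpow : ∀ r : R, r ^ p ∈ N := fun r => Subring.subset_closure (Or.inl ⟨r, rfl⟩)
  have hxN : x ∈ N := Subring.subset_closure (Or.inr ⟨0, by simp⟩)
  have hz : ∀ i, z i ∈ N := fun i => Subring.subset_closure (Or.inr ⟨i.succ, by simp⟩)
  have hmap : N.map (Ideal.Quotient.mk (Ideal.span {x})) = ⊤ := by
    rw [eq_top_iff, ← h, Subring.closure_le]
    rintro _ (⟨r, rfl⟩ | ⟨i, rfl⟩)
    · obtain ⟨r, rfl⟩ := Ideal.Quotient.mk_surjective r
      exact ⟨r ^ p, hpow r, by simp⟩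
    · exact ⟨z i, hz i, rfl⟩
  have h1 : ∀ b : R, ∃ s ∈ N, ∃ t, b = s + x * t := by
    intro b
    have : Ideal.Quotient.mk (Ideal.span {x}) b ∈
      N.map (Ideal.Quotient.mk (Ideal.span {x})) := by rw [hmap]; trivial
    obtain ⟨s, hs, hsb⟩ := this
    rw [eq_comm, Ideal.Quotient.eq, Ideal.mem_span_singleton'] at hsb
    obtain ⟨t, ht⟩ := hsb
    exact ⟨s, hs, t, by linear_combination -ht⟩
  have h2 : ∀ k : ℕ, ∀ b : R, ∃ s ∈ N, ∃ t, b = s + x ^ k * t := by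
    intro k
    induction k with
    | zero => intro b; exact ⟨0, N.zero_mem, b, by simp⟩
    | succ k ih =>
      intro b
      obtain ⟨s, hs, t, rfl⟩ := ih b
      obtain ⟨s', hs', t', rfl⟩ := h1 t
      exact ⟨s + x ^ k * s', N.add_mem hs (N.mul_mem (N.pow_mem hxN k) hs'), t', by ring⟩
  exact nakayama_hom (frobenius R p) hF N (fun a => hpow a) x hx (h2 p)

theorem QInd.lift {R : Type*} [CommRing R] [IsLocalRing R] [IsNoetherianRing R] (p : ℕ)
    [Fact p.Prime]
    [CharP R p] (x : R) (hx : x ∈ IsLocalRing.maximalIdeal R)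
    (hreg : ∀ a : R, x * a = 0 → a = 0)
    {n : ℕ} (z : Fin n → R)
    (h : QInd p (fun i => Ideal.Quotient.mk (Ideal.span {x}) (z i))) :
    QInd p (Fin.cons x z : Fin (n + 1) → R) := by
  have hregk : ∀ (k : ℕ) (a : R), x ^ k * a = 0 → a = 0 := by
    intro k
    induction k with
    | zero => intro a ha; simpa using ha
    | succ k ih =>
      intro a ha
      rw [pow_succ, mul_assoc] at ha
      exact hreg _ (ih _ ha)
  have hdvd : ∀ c : (Fin n → Fin p) → R,
      x ∣ ∑ γ, c γ ^ p * ∏ i, z i ^ (γ i : ℕ) → ∀ γ, x ∣ c γ := by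
    intro c hc γ
    rw [← Ideal.mem_span_singleton, ← Ideal.Quotient.eq_zero_iff_mem] at hc ⊢
    refine h (fun γ => Ideal.Quotient.mk (Ideal.span {x}) (c γ)) ?_ γ
    rw [← hc]
    simp
  have hstep : ∀ c : (Fin (n + 1) → Fin p) → R,
      ∑ γ, c γ ^ p * ∏ i, (Fin.cons x z : Fin (n + 1) → R) i ^ (γ i : ℕ) = 0 →
      ∃ c' : (Fin (n + 1) → Fin p) → R, (∀ γ, c γ = x * c' γ) ∧
      ∑ γ, c' γ ^ p * ∏ i, (Fin.cons x z : Fin (n + 1) → R) i ^ (γ i : ℕ) = 0 := by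
    intro c hc
    have hall : ∀ (j : ℕ) (hj : j < p) (γ : Fin n → Fin p), x ∣ c (Fin.cons ⟨j, hj⟩ γ) := by
      intro j
      induction j using Nat.strong_induction_on with
      | _ j ih =>
        intro hj
        apply hdvd (fun γ => c (Fin.cons ⟨j, hj⟩ γ))
        rw [sum_cons, ← Finset.add_sum_erase _ _ (Finset.mem_univ (⟨j, hj⟩ : Fin p))] at hc
        have hrest : x ^ (j + 1) ∣ ∑ i ∈ Finset.univ.erase (⟨j, hj⟩ : Fin p),
            (∑ γ : Fin n → Fin p, c (Fin.cons i γ) ^ p * ∏ l, z l ^ (γ l : ℕ)) * x ^ (i : ℕ) := by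
          refine Finset.dvd_sum fun i hi => ?_
          have hij : (i : ℕ) ≠ j := fun h => (Finset.mem_erase.mp hi).1 (Fin.ext h)
          rcases lt_or_gt_of_ne hij with hlt | hgt
          · refine Dvd.dvd.mul_right ?_ _
            refine Finset.dvd_sum fun γ _ => Dvd.dvd.mul_right ?_ _
            exact (pow_dvd_pow x (by omega)).trans (pow_dvd_pow_of_dvd (ih i hlt i.isLt γ) p)
          · exact Dvd.dvd.mul_left (pow_dvd_pow x hgt) _
        obtain ⟨t, ht⟩ := hrest
        rw [ht] at hc
        refine ⟨-t, ?_⟩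
        rw [← sub_eq_zero]
        apply hregk j
        simp only at hc
        linear_combination hc
    choose c' hc' using fun γ : Fin (n + 1) → Fin p => hall (γ 0) (γ 0).isLt (Fin.tail γ)
    have hcc : ∀ γ, c γ = x * c' γ := by
      intro γ
      rw [← hc' γ]
      simp
    refine ⟨c', hcc, hregk p _ ?_⟩
    rw [← hc, Finset.mul_sum]
    refine Finset.sum_congr rfl fun γ _ => ?_
    rw [hcc γ]; ring
  have hk : ∀ (k : ℕ) (c : (Fin (n + 1) → Fin p) → R),
      ∑ γ, c γ ^ p * ∏ i, (Fin.cons x z : Fin (n + 1) → R) i ^ (γ i : ℕ) = 0 →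
      ∀ γ, c γ ∈ IsLocalRing.maximalIdeal R ^ k := by
    intro k
    induction k with
    | zero => intro c _ γ; simp
    | succ k ih =>
      intro c hc γ
      obtain ⟨c', h1, h2⟩ := hstep c hc
      rw [h1 γ, pow_succ']
      exact Ideal.mul_mem_mul hx (ih c' h2 γ)
  intro c hc γ
  have h0 := Ideal.iInf_pow_eq_bot_of_isLocalRing (IsLocalRing.maximalIdeal R)
    (IsLocalRing.maximalIdeal.isMaximal R).ne_top
  rw [← Ideal.mem_bot, ← h0, Ideal.mem_iInf]
  exact fun k => hk k c hc γ

theorem exists_pbasis (p : ℕ) [hp : Fact p.Prime] : ∀ (d : ℕ) {R : Type*} [CommRing R]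
    [IsLocalRing R] [IsNoetherianRing R] [CharP R p] (_ : (frobenius R p).Finite) (rs : List R)
    (_ : rs.length = d) (_ : RingTheory.Sequence.IsWeaklyRegular R rs)
    (_ : Ideal.ofList rs = IsLocalRing.maximalIdeal R),
    ∃ (n : ℕ) (z : Fin n → R) (J : Set (Fin n)), QInd p z ∧ QGen p z ∧
      Ideal.span (z '' J) = IsLocalRing.maximalIdeal R := by
  intro d
  induction d with
  | zero =>
    intro R _ _ _ _ hF rs hl hr hm
    rw [List.length_eq_zero_iff] at hl
    subst hl
    rw [Ideal.ofList_nil] at hm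
    let : Field R := (IsLocalRing.isField_iff_maximalIdeal_eq.mpr hm.symm).toField
    obtain ⟨n, z, h1, h2⟩ := exists_pbasis_field (k := R) p hF
    exact ⟨n, z, ∅, h1, h2, by simpa using hm⟩
  | succ d ih =>
    intro R _ _ _ _ hF rs hl hr hm
    obtain _ | ⟨x, rs⟩ := rs
    · simp at hl
    have hx : x ∈ IsLocalRing.maximalIdeal R := by
      rw [← hm]; exact Ideal.subset_span (by simp)
    rw [RingTheory.Sequence.isWeaklyRegular_cons_iff] at hr
    obtain ⟨hr1, hr2⟩ := hr
    have hreg : ∀ a : R, x * a = 0 → a = 0 := by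
      intro a ha
      exact hr1 (by simpa using ha)
    let π := Ideal.Quotient.mk (Ideal.span {x})
    have hπ : Function.Surjective π := Ideal.Quotient.mk_surjective
    have hne : Ideal.span {x} ≠ ⊤ := by
      intro h
      have h1 : Ideal.span {x} ≤ IsLocalRing.maximalIdeal R := by
        rw [Ideal.span_singleton_le_iff_mem]; exact hx
      rw [h, top_le_iff] at h1
      exact (IsLocalRing.maximalIdeal.isMaximal R).ne_top h1
    have : Nontrivial (R ⧸ Ideal.span {x}) := Ideal.Quotient.nontrivial_iff.mpr hne
    have : IsLocalRing (R ⧸ Ideal.span {x}) := IsLocalRing.of_surjective' π hπ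
    have : IsLocalHom π := IsLocalHom.of_surjective π hπ
    have : CharP (R ⧸ Ideal.span {x}) p := by
      have : ((p : ℕ) : R ⧸ Ideal.span {x}) = 0 := by
        rw [← map_natCast π, CharP.cast_eq_zero, map_zero]
      exact (CharP.charP_iff_prime_eq_zero hp.out).2 this
    have hcomap : (IsLocalRing.maximalIdeal (R ⧸ Ideal.span {x})).comap π =
        IsLocalRing.maximalIdeal R := IsLocalRing.maximalIdeal_comap π
    have hF' : (frobenius (R ⧸ Ideal.span {x}) p).Finite := by
      apply RingHom.Finite.of_comp_finite (f := π)
      have : (frobenius (R ⧸ Ideal.span {x}) p).comp π = π.comp (frobenius R p) := by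
        ext r; simp [frobenius_def]
      rw [this]
      exact (RingHom.Finite.of_surjective π hπ).comp hF
    have hreg' : RingTheory.Sequence.IsWeaklyRegular (R ⧸ Ideal.span {x}) (rs.map π) := by
      have e : QuotSMulTop x R ≃ₗ[R] R ⧸ Ideal.span {x} :=
        Submodule.quotEquivOfEq _ _ (by
          ext a
          simp [Submodule.mem_smul_pointwise_iff_exists, Ideal.mem_span_singleton, Dvd.dvd,
            eq_comm])
      rw [e.isWeaklyRegular_congr] at hr2
      exact (RingTheory.Sequence.isWeaklyRegular_map_algebraMap_iff
        (R ⧸ Ideal.span {x}) (R ⧸ Ideal.span {x}) rs).mpr hr2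
    have hm' : Ideal.ofList (rs.map π) = IsLocalRing.maximalIdeal (R ⧸ Ideal.span {x}) := by
      rw [← Ideal.map_comap_of_surjective π hπ (IsLocalRing.maximalIdeal _), hcomap, ← hm,
        ← Ideal.map_ofList, Ideal.ofList_cons, Ideal.map_sup]
      simp [π]
    obtain ⟨n, z', J, h1, h2, h3⟩ := ih hF' (rs.map π) (by simpa using hl) hreg' hm'
    choose z hz using fun i => hπ (z' i)
    have hzz : z' = fun i => π (z i) := by funext i; exact (hz i).symm
    subst hzz
    refine ⟨n + 1, Fin.cons x z, insert 0 (Fin.succ '' J), QInd.lift p x hx hreg z h1,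
      QGen.lift p hF x hx z h2, ?_⟩
    rw [← hcomap, ← h3]
    have : (fun i => π (z i)) '' J = π '' (z '' J) := by rw [Set.image_image]
    rw [this, ← Ideal.map_span, Ideal.comap_map_of_surjective π hπ, ← RingHom.ker_eq_comap_bot,
      Ideal.mk_ker, Set.image_insert_eq, Set.image_image, Ideal.span_insert, sup_comm]
    simp

open MvPolynomial in
/-- The monomial ideal `(X_i^q)`. -/
noncomputable def Iq (R : Type*) [CommRing R] (n q : ℕ) : Ideal (MvPolynomial (Fin n) R) :=
  Ideal.span (Set.range fun i : Fin n => (X i : MvPolynomial (Fin n) R) ^ q)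

open MvPolynomial in
theorem coeff_Iq {R : Type*} [CommRing R] {n q : ℕ} {P : MvPolynomial (Fin n) R}
    (hP : P ∈ Iq R n q) (a : Fin n →₀ ℕ) (ha : a.degree < q) : coeff a P = 0 := by
  have h1 : Iq R n q = Ideal.span ((fun s => monomial s (1 : R)) ''
      (Set.range fun i : Fin n => Finsupp.single i q)) := by
    rw [Iq, ← Set.range_comp]
    congr 2
    funext i
    simp [X_pow_eq_monomial]
  rw [h1, mem_ideal_span_monomial_image] at hP
  by_contra hne
  obtain ⟨_, ⟨i, rfl⟩, hi⟩ := hP a (by rwa [mem_support_iff])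
  have := hi i
  simp only [Finsupp.single_eq_same] at this
  have := Finsupp.le_degree i a
  omega

open MvPolynomial in
theorem exists_reduction {R : Type*} [CommRing R] {q : ℕ} (hq : 0 < q) {n : ℕ} (z : Fin n → R)
    (P : MvPolynomial (Fin n) R) :
    ∃ c : (Fin n → Fin q) → R, P - ∑ γ, C (c γ) * ∏ i, X i ^ (γ i : ℕ) ∈
      Ideal.span (Set.range fun i : Fin n => (X i : MvPolynomial (Fin n) R) ^ q - C (z i)) := by
  classical
  set K := Ideal.span (Set.range fun i : Fin n => (X i : MvPolynomial (Fin n) R) ^ q - C (z i))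
    with hK
  induction P using MvPolynomial.induction_on' with
  | monomial a r =>
    refine ⟨Pi.single (fun i => ⟨a i % q, Nat.mod_lt _ hq⟩) (r * ∏ i, z i ^ (a i / q)), ?_⟩
    rw [Finset.sum_eq_single (fun i => (⟨a i % q, Nat.mod_lt _ hq⟩ : Fin q))]
    · rw [Pi.single_eq_same, ← Ideal.Quotient.eq, monomial_eq, Finsupp.prod_fintype _ _ (by simp)]
      simp only [map_mul, map_prod, map_pow]
      rw [mul_assoc, ← Finset.prod_mul_distrib]
      congr 1
      refine Finset.prod_congr rfl fun i _ => ?_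
      have h1 : Ideal.Quotient.mk K (C (z i)) = Ideal.Quotient.mk K (X i) ^ q := by
        rw [← map_pow, eq_comm, Ideal.Quotient.eq]
        exact Ideal.subset_span ⟨i, rfl⟩
      rw [h1, ← pow_mul, ← pow_add, Nat.div_add_mod]
    · intro γ _ hγ
      rw [Pi.single_eq_of_ne hγ]; simp
    · simp
  | add P Q hP hQ =>
    obtain ⟨c, hc⟩ := hP
    obtain ⟨d, hd⟩ := hQ
    refine ⟨c + d, ?_⟩
    have := add_mem hc hd
    convert this using 1
    simp only [Pi.add_apply, map_add, add_mul, Finset.sum_add_distrib]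
    ring

open MvPolynomial in
theorem exists_taylor {R : Type*} [CommRing R] (p : ℕ) [hp : Fact p.Prime] [CharP R p] (e : ℕ)
    {n : ℕ} (z : Fin n → R) (h1 : QInd (p ^ e) z) (h2 : QGen (p ^ e) z) :
    ∃ τ : R → MvPolynomial (Fin n) R,
      (∀ a b, τ (a + b) - (τ a + τ b) ∈ Iq R n (p ^ e)) ∧
      (∀ a b, τ (a * b) - τ a * τ b ∈ Iq R n (p ^ e)) ∧
      (τ 1 - 1 ∈ Iq R n (p ^ e)) ∧
      (∀ a, coeff 0 (τ a) = a) ∧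
      (∀ i, τ (z i) - (C (z i) + X i) ∈ Iq R n (p ^ e)) := by
  have hq : 0 < p ^ e := pow_pos hp.out.pos e
  let F := iterateFrobenius R p e
  have hF : ∀ r, F r = r ^ p ^ e := fun r => iterateFrobenius_def p e r
  let ev : MvPolynomial (Fin n) R →+* R := eval₂Hom F z
  let Φ : MvPolynomial (Fin n) R →+* MvPolynomial (Fin n) R :=
    eval₂Hom (C.comp F) (fun i => C (z i) + X i)
  have hsurj : Function.Surjective ev := by
    rw [← RingHom.range_eq_top, eq_top_iff, ← h2, Subring.closure_le]
    rintro _ (⟨r, rfl⟩ | ⟨i, rfl⟩)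
    · exact ⟨C r, by simp [ev, hF]⟩
    · exact ⟨X i, by simp [ev]⟩
  have hev : ∀ P, coeff 0 (Φ P) = ev P := by
    intro P
    have : (constantCoeff (R := R) (σ := Fin n)).comp Φ = ev := by
      apply MvPolynomial.ringHom_ext
      · intro r; simp [Φ, ev]
      · intro i; simp [Φ, ev]
    exact congrArg (fun f : MvPolynomial (Fin n) R →+* R => f P) this
  have hker : ∀ P, ev P = 0 → Φ P ∈ Iq R n (p ^ e) := by
    intro P hP
    obtain ⟨c, hc⟩ := exists_reduction hq z P
    set K := Ideal.span (Set.range fun i : Fin n =>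
      (X i : MvPolynomial (Fin n) R) ^ (p ^ e) - C (z i)) with hK
    have hKev : K ≤ RingHom.ker ev := by
      rw [hK, Ideal.span_le]
      rintro _ ⟨i, rfl⟩
      simp [RingHom.mem_ker, ev, hF]
    have hKΦ : K ≤ (Iq R n (p ^ e)).comap Φ := by
      rw [hK, Ideal.span_le]
      rintro _ ⟨i, rfl⟩
      have : Φ (X i ^ (p ^ e) - C (z i)) = X i ^ (p ^ e) := by
        simp [Φ, hF, add_pow_char_pow]
      simp only [Ideal.coe_comap, Set.mem_preimage, SetLike.mem_coe]
      rw [this]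
      exact Ideal.subset_span ⟨i, rfl⟩
    have h3 := hKev hc
    rw [RingHom.mem_ker, map_sub, hP, zero_sub, neg_eq_zero] at h3
    have h4 := h1 c (by
      rw [← h3]
      simp [ev, hF])
    have h5 : P ∈ K := by simpa [h4] using hc
    exact hKΦ h5
  choose sec hsec using hsurj
  refine ⟨fun r => Φ (sec r), ?_, ?_, ?_, ?_, ?_⟩
  · intro a b
    rw [← map_add, ← map_sub]
    exact hker _ (by simp [hsec])
  · intro a b
    rw [← map_mul, ← map_sub]
    exact hker _ (by simp [hsec])
  · rw [← map_one Φ, ← map_sub]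
    exact hker _ (by simp [hsec])
  · intro a
    rw [hev, hsec]
  · intro i
    have : C (z i) + X i = Φ (X i) := by simp [Φ]
    rw [this, ← map_sub]
    refine hker _ ?_
    rw [map_sub, hsec]
    simp [ev]

open MvPolynomial in
theorem taylor_diffop {R : Type*} [CommRing R] {q n : ℕ}
    (τ : R → MvPolynomial (Fin n) R)
    (hadd : ∀ a b, τ (a + b) - (τ a + τ b) ∈ Iq R n q)
    (hmul : ∀ a b, τ (a * b) - τ a * τ b ∈ Iq R n q)
    (h0 : ∀ a, coeff 0 (τ a) = a) :
    ∀ (k : ℕ) (a : Fin n →₀ ℕ), a.degree = k → k < q →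
      ∃ D : R →+ R, IsDiffOp R k D ∧ ∀ r, D r = coeff a (τ r) := by
  classical
  intro k
  induction k using Nat.strong_induction_on with
  | _ k ih =>
    intro a ha hk
    let D : R →+ R := AddMonoidHom.mk' (fun r => coeff a (τ r)) (by
      intro x y
      have := coeff_Iq (hadd x y) a (by omega)
      simpa [sub_eq_zero] using this)
    refine ⟨D, ?_, fun r => rfl⟩
    have hD : ∀ r, D r = coeff a (τ r) := fun r => rfl
    obtain _ | k := k
    · rw [Finsupp.degree_eq_zero_iff] at ha
      subst ha
      intro r s
      rw [hD, hD, h0, h0]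
    · intro r
      have hex : ∀ b : Fin n →₀ ℕ, b.degree ≤ k →
          ∃ D : R →+ R, IsDiffOp R k D ∧ ∀ r, D r = coeff b (τ r) := by
        intro b hb
        obtain ⟨D, h1, h2⟩ := ih b.degree (by omega) b rfl (by omega)
        exact ⟨D, h1.mono hb, h2⟩
      let Db : (Fin n →₀ ℕ) → (R →+ R) := fun b =>
        if hb : b.degree ≤ k then (hex b hb).choose else 0
      have hDb1 : ∀ b, IsDiffOp R k (Db b) := by
        intro b
        by_cases hb : b.degree ≤ k
        · simp only [Db, hb, dite_true]; exact (hex b hb).choose_spec.1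
        · simp only [Db, hb, dite_false]; exact IsDiffOp.zero k
      have hDb2 : ∀ b, b.degree ≤ k → ∀ s, Db b s = coeff b (τ s) := by
        intro b hb
        simp only [Db, hb, dite_true]; exact (hex b hb).choose_spec.2
      have key : (D.comp (AddMonoidHom.mulLeft r)) - ((AddMonoidHom.mulLeft r).comp D) =
          ∑ x ∈ (Finset.HasAntidiagonal.antidiagonal a).erase (0, a),
            (AddMonoidHom.mulLeft (coeff x.1 (τ r))).comp (Db x.2) := by
        ext s
        have h1 := coeff_Iq (hmul r s) a (by omega)
        rw [coeff_sub, sub_eq_zero, coeff_mul,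
          ← Finset.add_sum_erase _ _ (show ((0 : Fin n →₀ ℕ), a) ∈ Finset.HasAntidiagonal.antidiagonal a by simp),
          h0] at h1
        simp only [AddMonoidHom.sub_apply, AddMonoidHom.comp_apply, AddMonoidHom.coe_mulLeft,
          AddMonoidHom.finsetSum_apply, hD, h1, add_sub_cancel_left]
        refine Finset.sum_congr rfl fun x hx => ?_
        rw [Finset.mem_erase, Finset.HasAntidiagonal.mem_antidiagonal] at hx
        rw [hDb2]
        have h3 : x.1.degree + x.2.degree = k + 1 := by
          rw [← ha, ← hx.2, map_add]
        have h4 : x.1.degree ≠ 0 := by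
          intro h
          rw [Finsupp.degree_eq_zero_iff] at h
          apply hx.1
          ext1
          · exact h
          · simpa [h] using hx.2
        omega
      rw [key]
      exact IsDiffOp.sum _ _ fun x _ => IsDiffOp.mul_left _ _ (hDb1 _) _

open MvPolynomial in
theorem euler_key {R : Type*} [CommRing R] [IsLocalRing R] {q n : ℕ} (hq : 0 < q)
    (z : Fin n → R) (J : Set (Fin n)) (hJ : Ideal.span (z '' J) = IsLocalRing.maximalIdeal R)
    (τ : R → MvPolynomial (Fin n) R)
    (hadd : ∀ a b, τ (a + b) - (τ a + τ b) ∈ Iq R n q)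
    (hmul : ∀ a b, τ (a * b) - τ a * τ b ∈ Iq R n q)
    (h1 : τ 1 - 1 ∈ Iq R n q)
    (h0 : ∀ a, coeff 0 (τ a) = a)
    (hz : ∀ i, τ (z i) - (C (z i) + X i) ∈ Iq R n q)
    (g : R) (m l : ℕ) (hg : g ∈ IsLocalRing.maximalIdeal R ^ m) (hl0 : 0 < l) (hl : l < q)
    (hlm : l ≤ m)
    (hD : diffIdealPlus R l g ≤ IsLocalRing.maximalIdeal R ^ (m - l + 1)) :
    (m.choose l : R) * g ∈ IsLocalRing.maximalIdeal R ^ (m + 1) := by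
  classical
  set M := IsLocalRing.maximalIdeal R with hM
  let w : Fin n → R := fun i => if i ∈ J then z i else 0
  have hwM : ∀ i, w i ∈ M := by
    intro i
    by_cases hi : i ∈ J
    · simp only [w, hi, if_true]; rw [← hJ]; exact Ideal.subset_span ⟨i, hi, rfl⟩
    · simp [w, hi]
  let σ : MvPolynomial (Fin n) R →+* Polynomial R :=
    eval₂Hom Polynomial.C (fun i => Polynomial.C (w i) * Polynomial.X)
  have hσI : ∀ P ∈ Iq R n q, ∀ j < q, (σ P).coeff j = 0 := by
    intro P hP
    have : Iq R n q ≤ (Ideal.span {(Polynomial.X : Polynomial R) ^ q}).comap σ := by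
      rw [Iq, Ideal.span_le]
      rintro _ ⟨i, rfl⟩
      simp only [Ideal.coe_comap, Set.mem_preimage, SetLike.mem_coe, Ideal.mem_span_singleton]
      simp only [σ, coe_eval₂Hom, eval₂_pow, eval₂_X, mul_pow]
      exact Dvd.intro_left _ rfl
    have := this hP
    rw [Ideal.mem_comap, Ideal.mem_span_singleton, Polynomial.X_pow_dvd_iff] at this
    exact this
  let E : R → ℕ → R := fun r j => (σ (τ r)).coeff j
  have hσ : ∀ (r : R) (j : ℕ), E r j = ∑ a ∈ (τ r).support,
      if j = a.degree then coeff a (τ r) * ∏ i, w i ^ a i else 0 := by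
    intro r j
    simp only [E, σ, coe_eval₂Hom, eval₂_eq', Polynomial.finsetSum_coeff]
    refine Finset.sum_congr rfl fun a _ => ?_
    have : ∏ i, (Polynomial.C (w i) * Polynomial.X) ^ a i =
        Polynomial.C (∏ i, w i ^ a i) * Polynomial.X ^ a.degree := by
      simp only [mul_pow, Finset.prod_mul_distrib, map_prod, map_pow, Finsupp.degree_eq_sum,
        Finset.prod_pow_eq_pow_sum]
    rw [this, Polynomial.coeff_C_mul, Polynomial.coeff_C_mul, Polynomial.coeff_X_pow]
    split_ifs <;> simp
  have hw : ∀ a : Fin n →₀ ℕ, ∏ i, w i ^ a i ∈ M ^ a.degree := by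
    intro a
    rw [Finsupp.degree_eq_sum, ← Finset.prod_pow_eq_pow_sum]
    exact Ideal.prod_mem_prod fun i _ => Ideal.pow_mem_pow (hwM i) _
  have hE0 : ∀ r, E r 0 = r := by
    intro r
    have : (Polynomial.constantCoeff).comp σ = constantCoeff := by
      apply MvPolynomial.ringHom_ext
      · intro r; simp [σ]
      · intro i; simp [σ]
    have := congrArg (fun f : MvPolynomial (Fin n) R →+* R => f (τ r)) this
    exact this.trans (h0 r)
  have hEadd : ∀ a b j, j < q → E (a + b) j = E a j + E b j := by
    intro a b j hj
    have := hσI _ (hadd a b) j hj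
    simpa [sub_eq_zero] using this
  have hEM : ∀ r j, 0 < j → E r j ∈ M := by
    intro r j hj
    rw [hσ]
    refine sum_mem fun a _ => ?_
    split_ifs with h
    · refine Ideal.mul_mem_left _ _ (Ideal.pow_le_self (n := j) (by omega) ?_)
      rw [h]; exact hw a
    · exact zero_mem _
  have hEz : ∀ r i, i ∈ J → ∀ j, j + 1 < q → E (r * z i) (j + 1) = (E r (j + 1) + E r j) * z i := by
    intro r i hi j hj
    have e1 := hσI _ (hmul r (z i)) (j + 1) hj
    have e2 := hσI _ (Ideal.mul_mem_left _ (τ r) (hz i)) (j + 1) hj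
    have e3 : (σ (τ (r * z i))).coeff (j + 1) = (σ (τ r * (C (z i) + X i))).coeff (j + 1) := by
      rw [← sub_eq_zero, ← Polynomial.coeff_sub, ← map_sub]
      have : τ (r * z i) - τ r * (C (z i) + X i) =
        (τ (r * z i) - τ r * τ (z i)) + τ r * (τ (z i) - (C (z i) + X i)) := by ring
      rw [this, map_add, Polynomial.coeff_add, e1, e2, add_zero]
    have e4 : σ (C (z i) + X i) = Polynomial.C (z i) + Polynomial.C (z i) * Polynomial.X := by
      simp [σ, w, hi]
    change (σ (τ (r * z i))).coeff (j + 1) = ((σ (τ r)).coeff (j + 1) + (σ (τ r)).coeff j) * z i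
    rw [e3, map_mul, e4, mul_add, ← mul_assoc, Polynomial.coeff_add, Polynomial.coeff_mul_X,
      Polynomial.coeff_mul_C, Polynomial.coeff_mul_C]
    ring
  have hcong : ∀ (k : ℕ) (r : R), r ∈ M ^ k → ∀ j < q,
      E r j - (k.choose j : R) * r ∈ M ^ (k + 1) := by
    intro k
    induction k with
    | zero =>
      intro r _ j hj
      obtain _ | j := j
      · simp [hE0]
      · simpa using hEM r (j + 1) (by omega)
    | succ k ih =>
      have hQadd : ∀ a b : R, (∀ j < q, E a j - ((k + 1).choose j : R) * a ∈ M ^ (k + 1 + 1)) →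
          (∀ j < q, E b j - ((k + 1).choose j : R) * b ∈ M ^ (k + 1 + 1)) →
          (∀ j < q, E (a + b) j - ((k + 1).choose j : R) * (a + b) ∈ M ^ (k + 1 + 1)) := by
        intro a b ha hb j hj
        have := add_mem (ha j hj) (hb j hj)
        rw [hEadd a b j hj]
        convert this using 1
        ring
      intro r hr
      rw [pow_succ] at hr
      refine Submodule.mul_induction_on hr ?_ hQadd
      intro s hs y hy
      replace hy : y ∈ Ideal.span (z '' J) := by rw [hJ]; exact hy
      revert s
      induction hy using Submodule.span_induction with
      | mem y hy =>
        obtain ⟨i, hi, rfl⟩ := hy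
        intro s hs j hj
        have hzi : z i ∈ M := by rw [← hJ]; exact Ideal.subset_span ⟨i, hi, rfl⟩
        obtain _ | j := j
        · simp [hE0]
        · rw [hEz s i hi j hj, Nat.choose_succ_succ, pow_succ]
          have := Ideal.mul_mem_mul (add_mem (ih s hs (j + 1) hj) (ih s hs j (by omega))) hzi
          convert this using 1
          push_cast
          ring
      | zero =>
        intro s _ j hj
        have := hEadd 0 0 j hj
        simp only [add_zero, left_eq_add] at this
        simp [this]
      | add y y' _ _ h h' =>
        intro s hs
        rw [mul_add]
        exact hQadd _ _ (h s hs) (h' s hs)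
      | smul a y _ h =>
        intro s hs
        rw [smul_eq_mul, ← mul_assoc]
        exact h (s * a) (Ideal.mul_mem_right _ _ hs)
  have hEl : E g l ∈ M ^ (m + 1) := by
    rw [hσ]
    refine sum_mem fun a _ => ?_
    split_ifs with h
    · obtain ⟨D, hD1, hD2⟩ := taylor_diffop τ hadd hmul h0 l a h.symm hl
      have h5 : D 1 = 0 := by
        rw [hD2]
        have := coeff_Iq h1 a (by omega)
        rw [coeff_sub, sub_eq_zero] at this
        rw [this, coeff_one, if_neg]
        rintro rfl
        simp at h
        omega
      have h6 : coeff a (τ g) ∈ M ^ (m - l + 1) := hD (Ideal.subset_span ⟨D, hD1, h5, hD2 g⟩)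
      have h7 := Ideal.mul_mem_mul h6 (hw a)
      rw [← pow_add, ← h] at h7
      rwa [show m - l + 1 + l = m + 1 by omega] at h7
    · exact zero_mem _
  have := sub_mem hEl (hcong m g hg l hl)
  simpa using this

theorem not_dvd_choose (p : ℕ) [hp : Fact p.Prime] (m' : ℕ) (h : ¬ p ∣ m') :
    ∀ s : ℕ, ¬ p ∣ (p ^ s * m').choose (p ^ s) := by
  intro s
  induction s with
  | zero => simpa using h
  | succ s ih =>
    intro hd
    apply ih
    have h1 := Choose.choose_modEq_choose_mod_mul_choose_div_nat (n := p ^ (s + 1) * m')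
      (k := p ^ (s + 1)) (p := p)
    have e1 : p ^ (s + 1) * m' = p * (p ^ s * m') := by ring
    have e2 : p ^ (s + 1) = p * p ^ s := by ring
    rw [e1, e2, Nat.mul_mod_right, Nat.mul_mod_right, Nat.mul_div_cancel_left _ hp.out.pos,
      Nat.mul_div_cancel_left _ hp.out.pos, Nat.choose_self, one_mul, ← e1, ← e2] at h1
    exact (h1.dvd_iff dvd_rfl).mp hd

theorem nuQ_le_etaF_aux (R : Type*) [CommRing R] [IsLocalRing R]
    (p : ℕ) [Fact p.Prime] [CharP R p] (e : ℕ) (f : R) :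
    nuQ R (p ^ e) f ≤ etaF R (p ^ e) f := by
  refine sSup_le ?_
  rintro _ ⟨m, rfl, lam, hlam⟩
  refine le_iInf₂ fun i hi => ?_
  rw [Finset.mem_Icc] at hi
  have h1 : diffIdealPlus R i f ≤ IsLocalRing.maximalIdeal R ^ (m - i) := by
    rw [diffIdealPlus, Ideal.span_le]
    rintro _ ⟨D, hD, hD1, rfl⟩
    have h2 := IsDiffOp.mem_pow _ i D hD m _ hlam
    have h3 := IsDiffOp.pow_comm p e i (by omega) D hD lam 1
    rw [hD1, mul_zero, mul_one] at h3
    rw [map_sub, h3, sub_zero] at h2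
    exact h2
  have h2 : ((m - i : ℕ) : ℕ∞) ≤ ordIdeal R (diffIdealPlus R i f) := le_sSup ⟨_, rfl, h1⟩
  calc (m : ℕ∞) ≤ ((m - i + i : ℕ) : ℕ∞) := by exact_mod_cast (by omega)
    _ = ((m - i : ℕ) : ℕ∞) + i := by push_cast; rfl
    _ ≤ _ := by gcongr

/-- In an `F`-finite regular local ring of characteristic `p > 0`, `q = p ^ e`:
`ν^{(q)}(f) ≤ η(f)`, with equality whenever `ν^{(q)}(f)` is finite and not divisible
by `q`. -/
theorem nuQ_le_etaF_and_eq_of_not_dvd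
    (R : Type*) [CommRing R] [IsDomain R] [IsLocalRing R] (hreg : IsRegularLocal R)
    (p : ℕ) [Fact p.Prime] [CharP R p]
    (hF : Module.Finite (↥(frobenius R p).range) R)
    (e q : ℕ) (hq : q = p ^ e) (f : R) :
    nuQ R q f ≤ etaF R q f ∧
      (∀ m : ℕ, nuQ R q f = (m : ℕ∞) → ¬ q ∣ m → nuQ R q f = etaF R q f) := by
  subst hq
  have hle := nuQ_le_etaF_aux R p e f
  refine ⟨hle, fun m hm hdvd => le_antisymm hle ?_⟩
  obtain ⟨hN, rs, hrs, hspan⟩ := hreg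
  have hFin : (frobenius R p).Finite := by
    have h1 : ((frobenius R p).range.subtype).Finite := hF
    have h2 : ((frobenius R p).rangeRestrict).Finite :=
      RingHom.Finite.of_surjective _ (frobenius R p).rangeRestrict_surjective
    exact h1.comp h2
  obtain ⟨n, z, J, hI, hG, hJ⟩ := exists_pbasis p rs.length hFin rs rfl hrs.toIsWeaklyRegular hspan
  obtain ⟨τ, hadd, hmul, hone, h0, hz⟩ := exists_taylor p e z (hI.pow p z e) (hG.pow p z e)
  have hm0 : m ≠ 0 := by rintro rfl; exact hdvd (dvd_zero _)
  -- the supremum is attained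
  obtain ⟨lam, hlam⟩ : ∃ lam : R, f - lam ^ (p ^ e) ∈ IsLocalRing.maximalIdeal R ^ m := by
    by_contra hcon
    have : nuQ R (p ^ e) f ≤ ((m - 1 : ℕ) : ℕ∞) := by
      refine sSup_le ?_
      rintro _ ⟨k, rfl, lam, hk⟩
      have : k < m := by
        by_contra hkm
        exact hcon ⟨lam, Ideal.pow_le_pow_right (by omega) hk⟩
      exact_mod_cast (by omega : k ≤ m - 1)
    rw [hm] at this
    have : m ≤ m - 1 := by exact_mod_cast this
    omega
  have hnot : f - lam ^ (p ^ e) ∉ IsLocalRing.maximalIdeal R ^ (m + 1) := by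
    intro hcon
    have : ((m + 1 : ℕ) : ℕ∞) ≤ nuQ R (p ^ e) f := le_sSup ⟨m + 1, rfl, lam, hcon⟩
    rw [hm] at this
    have : m + 1 ≤ m := by exact_mod_cast this
    omega
  have hp : p.Prime := Fact.out
  obtain ⟨s, m', hm', hmm⟩ := Nat.exists_eq_pow_mul_and_not_dvd hm0 p hp.ne_one
  have hse : s < e := by
    by_contra hcon
    apply hdvd
    rw [hmm]
    exact Dvd.dvd.mul_right (pow_dvd_pow p (by omega)) _
  have hl : p ^ s < p ^ e := Nat.pow_lt_pow_right hp.one_lt hse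
  have hl0 : 0 < p ^ s := pow_pos hp.pos s
  have hlm : p ^ s ≤ m := Nat.le_of_dvd (by omega) ⟨m', hmm⟩
  have hsub : diffIdealPlus R (p ^ s) (f - lam ^ p ^ e) ≤ diffIdealPlus R (p ^ s) f := by
    rw [diffIdealPlus, Ideal.span_le]
    rintro _ ⟨D, hD, hD1, rfl⟩
    refine Ideal.subset_span ⟨D, hD, hD1, ?_⟩
    have h3 := IsDiffOp.pow_comm p e _ hl D hD lam 1
    rw [hD1, mul_zero, mul_one] at h3
    rw [map_sub, h3, sub_zero]
  have hord : ordIdeal R (diffIdealPlus R (p ^ s) f) ≤ ((m - p ^ s : ℕ) : ℕ∞) := by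
    refine sSup_le ?_
    rintro _ ⟨k, rfl, hk⟩
    by_contra hcon
    have hk' : m - p ^ s + 1 ≤ k := by
      by_contra h
      exact hcon (by exact_mod_cast (by omega : k ≤ m - p ^ s))
    have key := euler_key (pow_pos hp.pos e) z J hJ τ hadd hmul hone h0 hz _ m (p ^ s) hlam hl0 hl
      hlm (hsub.trans (hk.trans (Ideal.pow_le_pow_right hk')))
    have hunit : IsUnit ((m.choose (p ^ s) : ℕ) : R) := by
      have hc : ¬ p ∣ m.choose (p ^ s) := by rw [hmm]; exact not_dvd_choose p m' hm' s
      have hcop : Nat.Coprime (m.choose (p ^ s)) p := ((Nat.Prime.coprime_iff_not_dvd hp).mpr hc).symm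
      exact (CharP.isUnit_natCast_iff hp).mpr hc
    obtain ⟨u, hu⟩ := hunit
    rw [← hu] at key
    exact hnot (((IsLocalRing.maximalIdeal R ^ (m + 1)).unit_mul_mem_iff_mem u.isUnit).mp key)
  rw [hm]
  calc etaF R (p ^ e) f ≤ ordIdeal R (diffIdealPlus R (p ^ s) f) + ((p ^ s : ℕ) : ℕ∞) :=
        iInf₂_le (p ^ s) (Finset.mem_Icc.mpr ⟨hl0, by omega⟩)
    _ ≤ ((m - p ^ s : ℕ) : ℕ∞) + ((p ^ s : ℕ) : ℕ∞) := by gcongr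
    _ = (m : ℕ∞) := by rw [← Nat.cast_add]; congr 1; omega
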